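/- Let r < m and let P ∈ R_m satisfy deg(P) ≤ r and w(ev(P)) = 3·2^{m−r−1}. Then there exist r+2 linearly independent affine forms y_1,…,y_{r+2} ∈ R_m such that P = y_1⋯y_{r−2}(y_{r−1}y_r + y_{r+1}y_{r+2}). -/

import Mathlib

open Finset Pointwise

/-- Points of the affine space `F_2^m`. -/
abbrev Point (m : ℕ) := Fin m → ZMod 2

/-- The ring `R_m = F_2[x_0,…,x_{m-1}]/(x_i^2 - x_i)`, identified with the ring of
functions `F_2^m → F_2` via the evaluation isomorphism `ev`. -/
abbrev Fn (m : ℕ) := Point m → ZMod 2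

/-- The monomial `∏_{i ∈ S} x_i` (as the function it evaluates to). -/
def monFn (m : ℕ) (S : Finset (Fin m)) : Fn m := fun u => ∏ i ∈ S, u i

/-- Hamming weight of `ev(P)`: the number of points where `P` takes the value 1. -/
def wt (m : ℕ) (P : Fn m) : ℕ := (Finset.univ.filter fun u => P u = 1).card

/-- The monomial code `C(I)`: the `F_2`-span of the evaluations of the monomials in `I`. -/
def code (m : ℕ) (I : Set (Finset (Fin m))) : Submodule (ZMod 2) (Fn m) :=
  Submodule.span (ZMod 2) (monFn m '' I)

/-- `f ≼_sh g` for monomials of equal degree: the sorted index lists compare entrywise. -/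
def shLE (m : ℕ) (S T : Finset (Fin m)) : Prop :=
  S.card = T.card ∧
    ∀ (ℓ : ℕ) (hS : ℓ < (S.sort (· ≤ ·)).length) (hT : ℓ < (T.sort (· ≤ ·)).length),
      (S.sort (· ≤ ·)).get ⟨ℓ, hS⟩ ≤ (T.sort (· ≤ ·)).get ⟨ℓ, hT⟩

/-- `f ≼ g` iff there is a monomial `g*` with `f ≼_sh g* ≼_w g`. -/
def pre (m : ℕ) (S T : Finset (Fin m)) : Prop :=
  ∃ U : Finset (Fin m), shLE m S U ∧ U ⊆ T

/-- A decreasing set of monomials. -/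
def Decreasing (m : ℕ) (I : Set (Finset (Fin m))) : Prop :=
  ∀ f ∈ I, ∀ g : Finset (Fin m), pre m g f → g ∈ I

/-- The affine map `u ↦ B u + ε` on `F_2^m`. -/
def affMap (m : ℕ) (B : Fin m → Fin m → ZMod 2) (ε : Point m) (u : Point m) : Point m :=
  fun i => (∑ j, B i j * u j) + ε i

/-- `B` is lower triangular with unit diagonal. -/
def IsLT (m : ℕ) (B : Fin m → Fin m → ZMod 2) : Prop :=
  (∀ i, B i i = 1) ∧ ∀ i j : Fin m, i < j → B i j = 0

/-- The action of `(B,ε) ∈ LTA(m,2)` on `R_m`: substitute `x_i ↦ x_i + Σ_{j<i} b_{i,j} x_j + ε_i`.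
In the function representation this is precomposition with the affine map. -/
def act (m : ℕ) (B : Fin m → Fin m → ZMod 2) (ε : Point m) (P : Fn m) : Fn m :=
  fun u => P (affMap m B ε u)

/-- The orbit `LTA(m,2)·P`. -/
def orbit (m : ℕ) (P : Fn m) : Set (Fn m) :=
  {Q | ∃ B ε, IsLT m B ∧ Q = act m B ε P}

/-- Membership in the subgroup `LTA(m,2)_g` for the monomial `g` with index set `S`:
`ε_i = 0` if `i ∉ ind(g)`, and `b_{i,j} = 0` (off the diagonal) if `i ∉ ind(g)` or `j ∈ ind(g)`. -/
def IsLTsub (m : ℕ) (S : Finset (Fin m)) (B : Fin m → Fin m → ZMod 2) (ε : Point m) : Prop :=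
  IsLT m B ∧ (∀ i, i ∉ S → ε i = 0) ∧
    ∀ i j : Fin m, j ≠ i → (i ∉ S ∨ j ∈ S) → B i j = 0

/-- The orbit `LTA(m,2)_g · P` where `S = ind(g)`. -/
def orbitSub (m : ℕ) (S : Finset (Fin m)) (P : Fn m) : Set (Fn m) :=
  {Q | ∃ B ε, IsLTsub m S B ε ∧ Q = act m B ε P}

/-- `λ_f(i) = |{j : j < i, j ∉ ind(f)}|` where `S = ind(f)`. -/
def lam (m : ℕ) (S : Finset (Fin m)) (i : Fin m) : ℕ :=
  (Finset.univ.filter fun j => j < i ∧ j ∉ S).card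

/-- `|λ_f(g)| = Σ_{i ∈ ind(g)} λ_f(i)`. -/
def lamSum (m : ℕ) (S T : Finset (Fin m)) : ℕ := ∑ i ∈ T, lam m S i

/-- The affine form `c + Σ_i a_i x_i`. -/
def affForm (m : ℕ) (c : ZMod 2) (a : Point m) : Fn m := fun u => c + ∑ i, a i * u i

/-- `deg(P) ≤ r`: `P` lies in the span of the (multilinear) monomials of degree at most `r`. -/
def degLE (m : ℕ) (P : Fn m) (r : ℕ) : Prop :=
  P ∈ Submodule.span (ZMod 2)
    {Q : Fn m | ∃ S : Finset (Fin m), S.card ≤ r ∧ Q = monFn m S}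


universe u

section Weight

variable {V W : Type*} [Finite V] [Finite W]

/-- The number of points at which a Boolean function takes the value `1`. -/
noncomputable def hWeight (f : V → ZMod 2) : ℕ :=
  letI := Fintype.ofFinite V
  ∑ u, (f u).val

lemma hWeight_eq_sum [Fintype V] (f : V → ZMod 2) : hWeight f = ∑ u, (f u).val := by
  unfold hWeight
  congr
  exact Subsingleton.elim _ _

lemma hWeight_comp_equiv (e : W ≃ V) (f : V → ZMod 2) : hWeight (fun u => f (e u)) = hWeight f := by
  have := Fintype.ofFinite V
  have := Fintype.ofFinite W
  rw [hWeight_eq_sum, hWeight_eq_sum]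
  exact Fintype.sum_equiv e _ _ fun _ => rfl

lemma hWeight_one : hWeight (fun _ : V => 1) = Nat.card V := by
  have := Fintype.ofFinite V
  rw [hWeight_eq_sum, Nat.card_eq_fintype_card]
  simp [ZMod.val_one]

lemma hWeight_mono {f g : V → ZMod 2} (h : ∀ u, f u = 1 → g u = 1) : hWeight f ≤ hWeight g := by
  have := Fintype.ofFinite V
  rw [hWeight_eq_sum, hWeight_eq_sum]
  refine Finset.sum_le_sum fun u _ => ?_
  have := h u
  revert this
  generalize f u = x
  generalize g u = y
  revert x y
  decide

lemma eq_of_hWeight_le {f g : V → ZMod 2} (h : ∀ u, f u = 1 → g u = 1)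
    (hle : hWeight g ≤ hWeight f) : f = g := by
  have := Fintype.ofFinite V
  have hval : ∀ u, (f u).val ≤ (g u).val := by
    intro u
    have := h u
    revert this
    generalize f u = x
    generalize g u = y
    revert x y
    decide
  have heq : hWeight f = hWeight g := le_antisymm (hWeight_mono h) hle
  rw [hWeight_eq_sum, hWeight_eq_sum, Finset.sum_eq_sum_iff_of_le fun u _ => hval u] at heq
  exact funext fun u => ZMod.val_injective 2 (heq u (Finset.mem_univ u))

lemma hWeight_add (f g : V → ZMod 2) :
    hWeight (fun u => f u + g u) + 2 * hWeight (fun u => f u * g u) = hWeight f + hWeight g := by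
  have := Fintype.ofFinite V
  simp only [hWeight_eq_sum, Finset.mul_sum, ← Finset.sum_add_distrib]
  refine Finset.sum_congr rfl fun u _ => ?_
  generalize f u = x
  generalize g u = y
  revert x y
  decide

lemma hWeight_mul_add_mul_one_add (f g : V → ZMod 2) :
    hWeight (fun u => f u * g u) + hWeight (fun u => f u * (1 + g u)) = hWeight f := by
  have := Fintype.ofFinite V
  simp only [hWeight_eq_sum, ← Finset.sum_add_distrib]
  refine Finset.sum_congr rfl fun u _ => ?_
  generalize f u = x
  generalize g u = y
  revert x y
  decide

lemma hWeight_pos {f : V → ZMod 2} {p : V} (hp : f p = 1) : 0 < hWeight f := by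
  have := Fintype.ofFinite V
  rw [hWeight_eq_sum]
  exact Finset.sum_pos' (fun _ _ => Nat.zero_le _) ⟨p, Finset.mem_univ p, by rw [hp]; decide⟩

lemma exists_eq_one_of_hWeight_ne_zero {f : V → ZMod 2} (h : hWeight f ≠ 0) : ∃ p, f p = 1 := by
  by_contra! hf
  have := Fintype.ofFinite V
  refine h ?_
  rw [hWeight_eq_sum]
  refine Finset.sum_eq_zero fun u _ => ?_
  have := hf u
  revert this
  generalize f u = x
  revert x
  decide

lemma hWeight_zero : hWeight (fun _ : V => 0) = 0 := by
  have := Fintype.ofFinite V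
  simp [hWeight_eq_sum]

lemma natCard_eq_hWeight (A : V → ZMod 2) : Nat.card {u // A u = 1} = hWeight A := by
  classical
  have := Fintype.ofFinite V
  rw [Nat.card_eq_fintype_card, Fintype.card_subtype, hWeight_eq_sum, Finset.card_filter]
  refine Finset.sum_congr rfl fun u _ => ?_
  generalize A u = x
  revert x
  decide

end Weight

section Degree

variable {V W : Type*} [AddCommGroup V] [AddCommGroup W]

/-- A Boolean function has degree at most `r` if all its `(r+1)`-fold derivatives vanish. -/
def DerivDegLE : ℕ → (V → ZMod 2) → Prop
  | 0, f => ∀ u v, f u = f v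
  | r + 1, f => ∀ v, DerivDegLE r fun u => f (u + v) + f u

lemma DerivDegLE.comp_affine {r : ℕ} {f : V → ZMod 2} (hf : DerivDegLE r f) (L : W →+ V) (p : V) :
    DerivDegLE r fun u => f (L u + p) := by
  induction r generalizing f with
  | zero => exact fun u v => hf _ _
  | succ r ih =>
    intro v
    convert ih (hf (L v)) using 4
    rw [map_add]
    abel

lemma DerivDegLE.add {r : ℕ} {f g : V → ZMod 2} (hf : DerivDegLE r f) (hg : DerivDegLE r g) :
    DerivDegLE r fun u => f u + g u := by
  induction r generalizing f g with
  | zero => exact fun u v => by simp only [hf u v, hg u v]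
  | succ r ih =>
    intro v
    convert ih (hf v) (hg v) using 2
    ring

lemma derivDegLE_const (r : ℕ) (c : ZMod 2) : DerivDegLE r fun _ : V => c := by
  induction r generalizing c with
  | zero => exact fun _ _ => rfl
  | succ r ih => exact fun _ => ih _

lemma DerivDegLE.succ {r : ℕ} {f : V → ZMod 2} (hf : DerivDegLE r f) : DerivDegLE (r + 1) f := by
  induction r generalizing f with
  | zero => exact fun v u w => by simp only [hf (u + v) u, hf (w + v) w, hf u w]
  | succ r ih => exact fun v => ih (hf v)

lemma DerivDegLE.mono {r s : ℕ} {f : V → ZMod 2} (hf : DerivDegLE r f) (h : r ≤ s) :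
    DerivDegLE s f := by
  induction s, h using Nat.le_induction with
  | base => exact hf
  | succ s _ ih => exact ih.succ

lemma DerivDegLE.const_mul {r : ℕ} {f : V → ZMod 2} (hf : DerivDegLE r f) (c : ZMod 2) :
    DerivDegLE r fun u => c * f u := by
  induction r generalizing f with
  | zero => exact fun u v => by simp only [hf u v]
  | succ r ih =>
    intro v
    convert ih (hf v) using 2
    ring

lemma DerivDegLE.mul_addMonoidHom {r : ℕ} {f : V → ZMod 2} (hf : DerivDegLE r f)
    (l : V →+ ZMod 2) : DerivDegLE (r + 1) fun u => l u * f u := by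
  induction r generalizing f with
  | zero =>
    intro v u w
    simp only [map_add, hf (u + v) 0, hf (w + v) 0, hf u 0, hf w 0]
    linear_combination (l u - l w) * f 0 * CharTwo.two_eq_zero (R := ZMod 2)
  | succ r ih =>
    intro v
    have h₁ := (hf.comp_affine (AddMonoidHom.id V) v).const_mul (l v)
    convert h₁.add (ih (hf v)) using 2 with u
    simp only [map_add, AddMonoidHom.id_apply]
    ring

lemma derivDegLE_monFn (m : ℕ) (S : Finset (Fin m)) : DerivDegLE S.card (monFn m S) := by
  classical
  induction S using Finset.induction_on with
  | empty => exact fun u v => by simp [monFn]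
  | insert i S hi ih =>
    rw [Finset.card_insert_of_notMem hi]
    convert ih.mul_addMonoidHom (Pi.evalAddMonoidHom (fun _ : Fin m => ZMod 2) i) using 2 with u
    simp [monFn, Finset.prod_insert hi]

lemma degLE.derivDegLE {m r : ℕ} {P : Fn m} (h : degLE m P r) : DerivDegLE r P := by
  unfold degLE at h
  induction h using Submodule.span_induction with
  | mem Q hQ =>
    obtain ⟨S, hS, rfl⟩ := hQ
    exact (derivDegLE_monFn m S).mono hS
  | zero => exact derivDegLE_const r 0
  | add P Q _ _ hP hQ => exact hP.add hQ
  | smul c P _ hP => exact hP.const_mul c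

lemma eq_const_of_deriv_eq_zero {f : V → ZMod 2} (h : ∀ v u, f (u + v) + f u = 0) (u w : V) :
    f u = f w := by
  have := h (w - u) u
  rw [add_sub_cancel, add_comm] at this
  exact CharTwo.add_eq_zero.mp this

lemma zmod_two_eq_one_of_ne_zero {x : ZMod 2} (h : x ≠ 0) : x = 1 := by
  revert x
  decide

/-- The minimum distance of the Reed–Muller code. -/
lemma DerivDegLE.card_le [Finite V] {r : ℕ} {f : V → ZMod 2} (hf : DerivDegLE r f) {p : V}
    (hp : f p = 1) : Nat.card V ≤ hWeight f * 2 ^ r := by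
  have hconst : (∀ u v, f u = f v) → ∀ s, Nat.card V ≤ hWeight f * 2 ^ s := by
    intro h s
    have : f = fun _ => 1 := funext fun u => by rw [h u p, hp]
    rw [this, hWeight_one]
    exact Nat.le_mul_of_pos_right _ (by positivity)
  induction r generalizing f p with
  | zero => exact hconst hf 0
  | succ r ih =>
    by_cases h : ∀ v u, f (u + v) + f u = 0
    · exact hconst (eq_const_of_deriv_eq_zero h) _
    push Not at h
    obtain ⟨v, u, h⟩ := h
    have h₁ := ih (hf v) (zmod_two_eq_one_of_ne_zero h) (by
      intro hc s
      have : (fun u => f (u + v) + f u) = fun _ => 1 := funext fun w => by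
        rw [hc w u, zmod_two_eq_one_of_ne_zero h]
      rw [this, hWeight_one]
      exact Nat.le_mul_of_pos_right _ (by positivity))
    have h₂ := hWeight_add (fun u => f (u + v)) f
    have h₃ : hWeight (fun u => f (u + v)) = hWeight f := hWeight_comp_equiv (Equiv.addRight v) f
    calc _ ≤ _ := h₁
      _ ≤ (2 * hWeight f) * 2 ^ r := by gcongr; omega
      _ = _ := by ring

end Degree

section Hyperplane

variable {V : Type u} [AddCommGroup V] [Module (ZMod 2) V]

/-- Projection onto the kernel of a functional `φ` along a vector `s` with `φ s = 1`. -/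
def projKer (φ : V →ₗ[ZMod 2] ZMod 2) {s : V} (hs : φ s = 1) : V →ₗ[ZMod 2] LinearMap.ker φ :=
  LinearMap.codRestrict (LinearMap.ker φ) (LinearMap.id + φ.smulRight s) fun t => by
    simp [hs, CharTwo.add_self_eq_zero]

lemma coe_projKer (φ : V →ₗ[ZMod 2] ZMod 2) {s : V} (hs : φ s = 1) (t : V) :
    (projKer φ hs t : V) = t + φ t • s :=
  rfl

lemma projKer_coe (φ : V →ₗ[ZMod 2] ZMod 2) {s : V} (hs : φ s = 1) (u : LinearMap.ker φ) :
    projKer φ hs u = u := by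
  ext
  simp [coe_projKer]

lemma projKer_self (φ : V →ₗ[ZMod 2] ZMod 2) {s : V} (hs : φ s = 1) : projKer φ hs s = 0 := by
  ext
  simp [coe_projKer, hs, ZModModule.add_self]

lemma projKer_decomp (φ : V →ₗ[ZMod 2] ZMod 2) {s : V} (hs : φ s = 1) (p t : V) :
    (projKer φ hs (t + p) : V) + p + (φ t + φ p) • s = t := by
  have h : (projKer φ hs (t + p) : V) + p + (φ t + φ p) • s =
      t + (p + p) + ((φ t + φ p) • s + (φ t + φ p) • s) := by
    rw [coe_projKer, map_add]
    abel
  rw [h, ZModModule.add_self, ZModModule.add_self, add_zero, add_zero]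

lemma exists_apply_eq_one {φ : V →ₗ[ZMod 2] ZMod 2} (hφ : φ ≠ 0) : ∃ s, φ s = 1 := by
  by_contra! h
  refine hφ (LinearMap.ext fun u => ?_)
  by_contra hu
  exact h u (zmod_two_eq_one_of_ne_zero hu)

lemma add_smul_cases {f : V → ZMod 2} {P : ZMod 2 → Prop} (w s : V) (k : ZMod 2)
    (h₀ : P (f w)) (h₁ : P (f (w + s))) : P (f (w + k • s)) := by
  rcases eq_or_ne k 0 with rfl | hk
  · simpa using h₀
  · rw [zmod_two_eq_one_of_ne_zero hk, one_smul]
    exact h₁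

lemma hWeight_split [Finite V] (φ : V →ₗ[ZMod 2] ZMod 2) {s : V} (hs : φ s = 1) (p : V)
    (f : V → ZMod 2) :
    hWeight f = hWeight (fun u : LinearMap.ker φ => f (u + p)) +
      hWeight (fun u : LinearMap.ker φ => f (u + (p + s))) := by
  classical
  let i : LinearMap.ker φ ⊕ LinearMap.ker φ → V :=
    Sum.elim (fun u => (u : V) + p) (fun u => (u : V) + (p + s))
  have hi : Function.Bijective i := by
    have hne (a b : LinearMap.ker φ) : (a : V) + p ≠ b + (p + s) := by
      intro h
      have := congrArg φ h
      simp only [map_add, LinearMap.mem_ker.mp a.2, LinearMap.mem_ker.mp b.2, zero_add, hs] at this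
      simp at this
    constructor
    · rintro (a | a) (b | b) h
      · simpa [i] using h
      · exact (hne a b h).elim
      · exact (hne b a h.symm).elim
      · simpa [i] using h
    · intro t
      have ht := projKer_decomp φ hs p t
      rcases eq_or_ne (φ t + φ p) 0 with h | h
      · exact ⟨Sum.inl (projKer φ hs (t + p)), by simpa [h, i] using ht⟩
      · rw [zmod_two_eq_one_of_ne_zero h, one_smul] at ht
        exact ⟨Sum.inr (projKer φ hs (t + p)), by simpa [i, add_assoc] using ht⟩
  have := Fintype.ofFinite (LinearMap.ker φ)
  rw [← hWeight_comp_equiv (Equiv.ofBijective i hi) f, hWeight_eq_sum, Fintype.sum_sum_type,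
    hWeight_eq_sum, hWeight_eq_sum]
  rfl

lemma card_eq_two_mul_card_ker [Finite V] (φ : V →ₗ[ZMod 2] ZMod 2) {s : V} (hs : φ s = 1) :
    Nat.card V = 2 * Nat.card (LinearMap.ker φ) := by
  have := hWeight_split φ hs 0 fun _ => 1
  simp only [hWeight_one] at this
  omega

lemma DerivDegLE.restrict {r : ℕ} {f : V → ZMod 2} (hf : DerivDegLE r f)
    (φ : V →ₗ[ZMod 2] ZMod 2) (p : V) : DerivDegLE r fun u : LinearMap.ker φ => f (u + p) :=
  hf.comp_affine (LinearMap.ker φ).subtype.toAddMonoidHom p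

lemma DerivDegLE.restrict_add {r : ℕ} {f : V → ZMod 2} (hf : DerivDegLE (r + 1) f)
    (φ : V →ₗ[ZMod 2] ZMod 2) (p s : V) :
    DerivDegLE r fun u : LinearMap.ker φ => f (u + p) + f (u + (p + s)) := by
  convert (hf s).restrict φ p using 2 with u
  rw [add_comm, add_assoc]

/-- A Boolean function whose support is empty or an affine subspace. -/
def IsFlat (f : V → ZMod 2) : Prop :=
  ∀ a b c, f a = 1 → f b = 1 → f c = 1 → f (a + b + c) = 1

section IsFlat

variable {A B : V → ZMod 2}

lemma IsFlat.mul_shift (hA : IsFlat A) (hB : IsFlat B) (hA₀ : A 0 = 1)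
    (hB₀ : B 0 ≠ 1) {b : V} (hAb : A b = 1) (hBb : B b = 1) (u : V)
    (hu : A (u + b) * B (u + b) = 1) : A u * (1 + B u) = 1 := by
  have h₁ : A (u + b) = 1 ∧ B (u + b) = 1 := by
    revert hu
    generalize A (u + b) = x
    generalize B (u + b) = y
    revert x y
    decide
  have h₂ : u + b + b + 0 = u := by rw [add_assoc u, ZModModule.add_self, add_zero, add_zero]
  have h₃ : A u = 1 := by simpa only [h₂] using hA _ _ _ h₁.1 hAb hA₀
  have h₄ : B u = 0 := by
    by_contra h
    refine hB₀ ?_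
    have := hB _ _ _ h₁.2 hBb (zmod_two_eq_one_of_ne_zero h)
    rwa [add_assoc u, ZModModule.add_self, add_zero, ZModModule.add_self] at this
  rw [h₃, h₄]
  decide

lemma IsFlat.two_mul_hWeight_mul_le [Finite V] (hA : IsFlat A) (hB : IsFlat B) (hA₀ : A 0 = 1)
    (hB₀ : B 0 ≠ 1) : 2 * hWeight (fun u => A u * B u) ≤ hWeight A := by
  rcases eq_or_ne (hWeight fun u => A u * B u) 0 with h | h
  · omega
  obtain ⟨b, hb⟩ := exists_eq_one_of_hWeight_ne_zero h
  have hb' : A b = 1 ∧ B b = 1 := by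
    revert hb
    generalize A b = x
    generalize B b = y
    revert x y
    decide
  have h₁ := hWeight_mono (hA.mul_shift hB hA₀ hB₀ hb'.1 hb'.2)
  have h₂ := hWeight_comp_equiv (Equiv.addRight b) fun u => A u * B u
  simp only [Equiv.coe_addRight] at h₂
  have h₃ := hWeight_mul_add_mul_one_add A B
  omega

lemma IsFlat.eq_one_or_of_two_mul_hWeight_mul_eq [Finite V] (hA : IsFlat A) (hB : IsFlat B)
    (hA₀ : A 0 = 1) (hB₀ : B 0 ≠ 1) (h : 2 * hWeight (fun u => A u * B u) = hWeight A)
    {b : V} (hAb : A b = 1) (hBb : B b = 1) {u : V} (hu : A u = 1) :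
    B u = 1 ∨ B (u + b) = 1 := by
  have h₂ := hWeight_comp_equiv (Equiv.addRight b) fun u => A u * B u
  simp only [Equiv.coe_addRight] at h₂
  have h₃ := hWeight_mul_add_mul_one_add A B
  have h₄ := congrFun (eq_of_hWeight_le (hA.mul_shift hB hA₀ hB₀ hAb hBb) (by omega)) u
  revert h₄
  rw [hu]
  generalize A (u + b) = x
  generalize B (u + b) = y
  generalize B u = z
  revert x y z
  decide

end IsFlat

/-- A codeword splitting into a minimum weight word and a different word of at most twice that
weight. -/
lemma DerivDegLE.isFlat_add_of_split [Finite V] {r : ℕ} {f : V → ZMod 2}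
    (hf : DerivDegLE (r + 1) f) (φ : V →ₗ[ZMod 2] ZMod 2) {p s : V} (hp : f p = 1)
    (hq : f (p + s) = 1)
    (hmin : ∀ g : LinearMap.ker φ → ZMod 2, DerivDegLE r g → (∃ x, g x = 1) →
      2 * hWeight g * 2 ^ r < 3 * Nat.card (LinearMap.ker φ) →
      IsFlat g ∧ hWeight g * 2 ^ r = Nat.card (LinearMap.ker φ))
    {A h B : LinearMap.ker φ → ZMod 2} (hAdef : A = fun u : LinearMap.ker φ => f (u + p))
    (hhdef : h = fun u : LinearMap.ker φ => f (u + (p + s))) (hBdef : B = fun u => A u + h u)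
    (hA : IsFlat A) (hAw : hWeight A * 2 ^ (r + 1) = Nat.card (LinearMap.ker φ))
    (hhw : hWeight h ≤ 2 * hWeight A) (hne : A ≠ h) :
    IsFlat B ∧ hWeight B = 2 * hWeight A ∧ hWeight h = 2 * hWeight A ∧
      2 * hWeight (fun u => A u * B u) = hWeight A := by
  have hA₀ : A 0 = 1 := by simpa [hAdef] using hp
  have hh₀ : h 0 = 1 := by simpa [hhdef] using hq
  have hB₀ : B 0 ≠ 1 := by
    rw [hBdef]
    simp only [hA₀, hh₀]
    decide
  have hBdeg : DerivDegLE r B := by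
    rw [hBdef, hAdef, hhdef]
    exact hf.restrict_add φ p s
  have hBex : ∃ x, B x = 1 := by
    by_contra! hB
    refine hne (funext fun u => ?_)
    have := hB u
    rw [hBdef] at this
    revert this
    simp only
    generalize A u = x
    generalize h u = y
    revert x y
    decide
  have hpos : 0 < 2 ^ r := by positivity
  have hpow : hWeight A * 2 ^ (r + 1) = (2 * hWeight A) * 2 ^ r := by ring
  have hBge : 2 * hWeight A ≤ hWeight B := by
    obtain ⟨x, hx⟩ := hBex
    have := hBdeg.card_le hx
    rw [← hAw, hpow] at this
    exact Nat.le_of_mul_le_mul_right this hpos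
  have hadd := hWeight_add A h
  rw [← hBdef] at hadd
  have hipos : 0 < hWeight fun u => A u * h u := hWeight_pos (p := 0) (by rw [hA₀, hh₀, one_mul])
  have hmul := hWeight_mul_add_mul_one_add A h
  have hAB : (fun u => A u * (1 + h u)) = fun u => A u * B u := by
    funext u
    rw [hBdef]
    simp only
    generalize A u = x
    generalize h u = y
    revert x y
    decide
  rw [hAB] at hmul
  obtain ⟨hB, hBw⟩ := hmin B hBdeg hBex (by
    rw [← hAw, hpow, ← mul_assoc]
    exact Nat.mul_lt_mul_of_pos_right (by omega) hpos)
  have hBeq : hWeight B = 2 * hWeight A := by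
    rw [← hAw, hpow] at hBw
    exact Nat.eq_of_mul_eq_mul_right hpos hBw
  have := hA.two_mul_hWeight_mul_le hB hA₀ hB₀
  exact ⟨hB, hBeq, by omega, by omega⟩

/-- Words of weight less than `3/2` of the minimum distance of the Reed–Muller code are the
indicators of flats and have minimum weight. -/
theorem DerivDegLE.isFlat_of_hWeight_lt [Finite V] {r : ℕ} {f : V → ZMod 2}
    (hf : DerivDegLE r f) (hex : ∃ x, f x = 1) (hw : 2 * hWeight f * 2 ^ r < 3 * Nat.card V) :
    IsFlat f ∧ hWeight f * 2 ^ r = Nat.card V := by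
  induction hn : Nat.card V using Nat.strong_induction_on generalizing V r with
  | h n ih =>
  subst hn
  obtain ⟨p, hp⟩ := hex
  cases r with
  | zero =>
    have : f = fun _ => 1 := funext fun u => by rw [hf u p, hp]
    subst this
    exact ⟨fun _ _ _ _ _ _ => rfl, by rw [hWeight_one, pow_zero, mul_one]⟩
  | succ r =>
  by_cases hsing : ∀ q, f q = 1 → q = p
  · constructor
    · intro a b c ha hb hc
      rw [hsing a ha, hsing b hb, hsing c hc, ZModModule.add_self, zero_add, hp]
    · have hle := hf.card_le hp
      obtain ⟨d, hd⟩ : ∃ d, Nat.card V = 2 ^ d :=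
        ⟨_, (Module.natCard_eq_pow_finrank (K := ZMod 2) (V := V)).trans (by rw [Nat.card_zmod])⟩
      have hwt : hWeight f = 1 := by
        classical
        have := Fintype.ofFinite V
        rw [hWeight_eq_sum, Finset.sum_eq_single p]
        · rw [hp]
          decide
        · intro b _ hb
          by_contra h
          refine hb (hsing b (zmod_two_eq_one_of_ne_zero fun h₀ => h ?_))
          rw [h₀]
          decide
        · simp
      rw [hwt, hd, one_mul] at hle
      rw [hwt, hd] at hw
      rw [hwt, hd, one_mul]
      have h₁ := (Nat.pow_le_pow_iff_right (by norm_num)).mp hle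
      have h₂ : r + 1 < d + 1 := by
        rw [← Nat.pow_lt_pow_iff_right (a := 2) (by norm_num), pow_succ 2 d]
        omega
      rw [show r + 1 = d by omega]
  push Not at hsing
  obtain ⟨q, hq, hqp⟩ := hsing
  obtain ⟨s, rfl⟩ : ∃ s, q = p + s := ⟨q - p, by abel⟩
  have hs₀ : s ≠ 0 := by
    rintro rfl
    simp at hqp
  obtain ⟨φ, hφ⟩ := Module.Projective.exists_dual_ne_zero (ZMod 2) hs₀
  have hs : φ s = 1 := zmod_two_eq_one_of_ne_zero hφ
  have hcard := card_eq_two_mul_card_ker φ hs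
  have hcpos : 0 < Nat.card (LinearMap.ker φ) := Nat.card_pos
  have hpos : 0 < 2 ^ r := by positivity
  have main : ∀ p, f p = 1 → f (p + s) = 1 →
      hWeight (fun u : LinearMap.ker φ => f (u + p)) ≤
        hWeight (fun u : LinearMap.ker φ => f (u + (p + s))) →
      IsFlat f ∧ hWeight f * 2 ^ (r + 1) = Nat.card V := by
    clear p hp hq hqp
    intro p hp hq hle
    have hsplit := hWeight_split φ hs p f
    obtain ⟨A, hAdef⟩ : ∃ A, A = fun u : LinearMap.ker φ => f (u + p) := ⟨_, rfl⟩
    obtain ⟨h, hhdef⟩ : ∃ h, h = fun u : LinearMap.ker φ => f (u + (p + s)) := ⟨_, rfl⟩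
    rw [← hAdef, ← hhdef] at hsplit hle
    have hlow : 2 * hWeight A * 2 ^ (r + 1) < 3 * Nat.card (LinearMap.ker φ) := by
      have : 2 * (2 * hWeight A) * 2 ^ (r + 1) ≤ 2 * hWeight f * 2 ^ (r + 1) := by
        gcongr
        omega
      linarith
    have hAdeg : DerivDegLE (r + 1) A := by
      rw [hAdef]
      exact hf.restrict φ p
    obtain ⟨hA, hAw⟩ := ih _ (by omega) hAdeg
      ⟨0, by simpa [hAdef] using hp⟩ hlow rfl
    have hhlt : hWeight h < 2 * hWeight A := by
      rw [hcard, ← hAw, hsplit] at hw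
      have : 2 * (hWeight A + hWeight h) < 3 * (2 * hWeight A) := by
        refine Nat.lt_of_mul_lt_mul_right (a := 2 ^ (r + 1)) ?_
        linarith
      omega
    by_cases hne : A = h
    · refine ⟨?_, by rw [hsplit, ← hne, hcard, ← hAw]; ring⟩
      have key (u : LinearMap.ker φ) (k : ZMod 2) : f (u + p + k • s) = A u := by
        refine add_smul_cases (P := fun x => x = A u) _ _ _ ?_ ?_
        · rw [hAdef]
        · rw [hne, hhdef, add_assoc]
      have key' (t : V) : f t = A (projKer φ hs (t + p)) := by
        rw [← key _ (φ t + φ p), projKer_decomp]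
      intro a b c ha hb hc
      rw [key'] at ha hb hc ⊢
      have := hA _ _ _ ha hb hc
      rw [← map_add, ← map_add] at this
      rw [← this]
      congr 2
      have : a + p + (b + p) + (c + p) = a + b + c + p + (p + p) := by abel
      rw [this, ZModModule.add_self, add_zero]
    · obtain ⟨-, -, hh, -⟩ := hf.isFlat_add_of_split φ hp hq
        (fun g hg hx hgw => ih _ (by omega) hg hx hgw rfl) hAdef hhdef rfl hA hAw hhlt.le hne
      omega
  rcases le_total (hWeight fun u : LinearMap.ker φ => f (u + p))
    (hWeight fun u : LinearMap.ker φ => f (u + (p + s))) with h | h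
  · exact main p hp hq h
  · have hpss : p + s + s = p := by rw [add_assoc, ZModModule.add_self, add_zero]
    exact main (p + s) hq (by rwa [hpss]) (by rwa [hpss])

/-- Over a nonconstant functional exactly half of the values are `1`. -/
lemma two_mul_hWeight_linearMap [Finite V] {φ : V →ₗ[ZMod 2] ZMod 2} (hφ : φ ≠ 0) :
    2 * hWeight φ = Nat.card V := by
  obtain ⟨s, hs⟩ := exists_apply_eq_one hφ
  have h := hWeight_split φ hs 0 φ
  have h₀ (u : LinearMap.ker φ) : φ (u + 0) = 0 := by simp
  have h₁ (u : LinearMap.ker φ) : φ (u + (0 + s)) = 1 := by simp [hs]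
  simp only [h₀, h₁, hWeight_zero, hWeight_one] at h
  rw [h, card_eq_two_mul_card_ker φ hs, zero_add]

/-- A Boolean function with a zero that is not identically zero is unbalanced with respect to
some hyperplane. -/
lemma exists_unbalanced [Finite V] {f : V → ZMod 2} (hf : hWeight f ≠ 0) {v : V} (hv : f v = 0) :
    ∃ φ : V →ₗ[ZMod 2] ZMod 2, φ ≠ 0 ∧ 2 * hWeight (fun u => f u * (φ u + φ v)) ≠ hWeight f := by
  classical
  by_contra! h
  have : Finite (V →ₗ[ZMod 2] ZMod 2) := Finite.of_injective _ DFunLike.coe_injective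
  have := Fintype.ofFinite (V →ₗ[ZMod 2] ZMod 2)
  have := Fintype.ofFinite V
  have hswap : ∑ φ : V →ₗ[ZMod 2] ZMod 2, 2 * hWeight (fun u => f u * (φ u + φ v)) =
      ∑ u, 2 * hWeight (fun φ : V →ₗ[ZMod 2] ZMod 2 => f u * (φ u + φ v)) := by
    simp only [hWeight_eq_sum, Finset.mul_sum]
    exact Finset.sum_comm
  have hright : ∑ u, 2 * hWeight (fun φ : V →ₗ[ZMod 2] ZMod 2 => f u * (φ u + φ v)) =
      hWeight f * Nat.card (V →ₗ[ZMod 2] ZMod 2) := by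
    rw [hWeight_eq_sum, Finset.sum_mul]
    refine Finset.sum_congr rfl fun u _ => ?_
    rcases eq_or_ne (f u) 0 with hu | hu
    · simp [hu, hWeight_zero]
    · have huv : u + v ≠ 0 := by
        intro h₀
        refine hu ?_
        rw [← hv]
        congr 1
        calc u = u + v + v := by rw [add_assoc, ZModModule.add_self, add_zero]
          _ = v := by rw [h₀, zero_add]
      obtain ⟨ψ, hψ⟩ := Module.Projective.exists_dual_ne_zero (ZMod 2) huv
      have hne : Module.Dual.eval (ZMod 2) V (u + v) ≠ 0 := fun h₀ => hψ (by
        rw [← Module.Dual.eval_apply, h₀, LinearMap.zero_apply])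
      rw [zmod_two_eq_one_of_ne_zero hu, ZMod.val_one, one_mul]
      rw [← two_mul_hWeight_linearMap hne]
      congr 2
      funext φ
      rw [one_mul, Module.Dual.eval_apply, map_add]
  have hleft : ∑ φ : V →ₗ[ZMod 2] ZMod 2, 2 * hWeight (fun u => f u * (φ u + φ v)) =
      (Nat.card (V →ₗ[ZMod 2] ZMod 2) - 1) * hWeight f := by
    rw [← Finset.sum_erase_add _ _ (Finset.mem_univ 0),
      Finset.sum_congr rfl fun φ hφ => h φ (Finset.ne_of_mem_erase hφ)]
    simp [hWeight_zero]
  rw [hswap, hright, mul_comm] at hleft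
  have hpos : 0 < Nat.card (V →ₗ[ZMod 2] ZMod 2) := Nat.card_pos
  have := Nat.eq_of_mul_eq_mul_right (Nat.pos_of_ne_zero hf) hleft
  omega

/-- `f = y₀ ⋯ y_{k-1} (y_k y_{k+1} + y_{k+2} y_{k+3})` for affine forms `y_j = c_j + φ_j` with
independent linear parts; independence is expressed as joint surjectivity. -/
def HasProductForm (k : ℕ) (f : V → ZMod 2) : Prop :=
  ∃ (c : ℕ → ZMod 2) (φ : ℕ → V →ₗ[ZMod 2] ZMod 2),
    (∀ t : ℕ → ZMod 2, ∃ u, ∀ j < k + 4, φ j u = t j) ∧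
    ∀ u, f u = (∏ j ∈ Finset.range k, (c j + φ j u)) *
      ((c k + φ k u) * (c (k + 1) + φ (k + 1) u) +
        (c (k + 2) + φ (k + 2) u) * (c (k + 3) + φ (k + 3) u))

lemma HasProductForm.of_restrict {k : ℕ} {f : V → ZMod 2} (φ : V →ₗ[ZMod 2] ZMod 2) {s : V}
    (hs : φ s = 1) (p : V) (h₀ : ∀ u : LinearMap.ker φ, f (u + p) = 0)
    (h₁ : HasProductForm k fun u : LinearMap.ker φ => f (u + (p + s))) :
    HasProductForm (k + 1) f := by
  obtain ⟨c, ψ, hsurj, hform⟩ := h₁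
  let c' : ℕ → ZMod 2 := fun j => Nat.casesOn j (φ p) fun j => c j + ψ j (projKer φ hs p)
  let ψ' : ℕ → V →ₗ[ZMod 2] ZMod 2 := fun j => Nat.casesOn j φ fun j => ψ j ∘ₗ projKer φ hs
  refine ⟨c', ψ', fun t => ?_, fun t => ?_⟩
  · obtain ⟨u, hu⟩ := hsurj fun j => t (j + 1)
    refine ⟨u + t 0 • s, fun j hj => ?_⟩
    cases j with
    | zero => simp [ψ', hs]
    | succ j =>
      have := hu j (by omega)
      simpa [ψ', projKer_coe, projKer_self] using this
  · have hsucc (j : ℕ) : c' (j + 1) + ψ' (j + 1) t = c j + ψ j (projKer φ hs (t + p)) := by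
      simp only [c', ψ', LinearMap.comp_apply, map_add]
      ring
    have hzero : c' 0 + ψ' 0 t = φ t + φ p := add_comm _ _
    rw [Finset.prod_range_succ', show k + 1 + 1 = (k + 1) + 1 from rfl,
      show k + 1 + 2 = (k + 2) + 1 from rfl, show k + 1 + 3 = (k + 3) + 1 from rfl]
    simp only [hsucc, hzero]
    rw [mul_right_comm, ← hform]
    have ht := projKer_decomp φ hs p t
    rcases eq_or_ne (φ t + φ p) 0 with h | h
    · rw [h, mul_zero]
      rw [h, zero_smul, add_zero] at ht
      rw [← ht, h₀]
    · rw [zmod_two_eq_one_of_ne_zero h, mul_one]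
      rw [zmod_two_eq_one_of_ne_zero h, one_smul, add_assoc] at ht
      simp only [ht]

/-- A linear subspace given by its Boolean indicator. -/
def IsFlat.toSubmodule {A : V → ZMod 2} (hA : IsFlat A) (hA₀ : A 0 = 1) : Submodule (ZMod 2) V :=
  AddSubgroup.toZModSubmodule 2
    { carrier := {u | A u = 1}
      zero_mem' := hA₀
      add_mem' := fun {a b} ha hb => by simpa using hA a b 0 ha hb hA₀
      neg_mem' := fun {a} ha => by rwa [ZModModule.neg_eq_self] }

lemma IsFlat.mem_toSubmodule {A : V → ZMod 2} (hA : IsFlat A) (hA₀ : A 0 = 1) {u : V} :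
    u ∈ hA.toSubmodule hA₀ ↔ A u = 1 :=
  Iff.rfl

/-- A flat of codimension two through the origin is cut out by two independent functionals. -/
lemma IsFlat.exists_eq_mul [Finite V] {A : V → ZMod 2} (hA : IsFlat A) (hA₀ : A 0 = 1)
    (hw : hWeight A * 4 = Nat.card V) : ∃ z : V →ₗ[ZMod 2] (Fin 2 → ZMod 2),
      Function.Surjective z ∧ ∀ u, A u = (1 + z u 0) * (1 + z u 1) := by
  let W := hA.toSubmodule hA₀
  have hcard := W.card_eq_card_quotient_mul_card
  have hW : Nat.card W = hWeight A := natCard_eq_hWeight A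
  have hq : Nat.card (V ⧸ W) = 4 := by
    rw [hW, ← hw, mul_comm] at hcard
    exact (Nat.eq_of_mul_eq_mul_left (hWeight_pos hA₀) ((mul_comm _ _).trans hcard)).symm
  have hrank : Module.finrank (ZMod 2) (V ⧸ W) = Module.finrank (ZMod 2) (Fin 2 → ZMod 2) := by
    rw [Module.natCard_eq_pow_finrank (K := ZMod 2), Nat.card_zmod] at hq
    rw [Module.finrank_fin_fun]
    exact Nat.pow_right_injective le_rfl (hq.trans (by norm_num))
  let e := LinearEquiv.ofFinrankEq _ _ hrank
  refine ⟨e.toLinearMap ∘ₗ W.mkQ, e.surjective.comp W.mkQ_surjective, fun u => ?_⟩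
  have hmem : A u = 1 ↔ e (W.mkQ u) = 0 := by
    rw [← hA.mem_toSubmodule hA₀, LinearEquiv.map_eq_zero_iff, Submodule.mkQ_apply,
      Submodule.Quotient.mk_eq_zero]
  have hzero : e (W.mkQ u) = 0 ↔ e (W.mkQ u) 0 = 0 ∧ e (W.mkQ u) 1 = 0 := by
    rw [funext_iff, Fin.forall_fin_two]
    rfl
  rw [hzero] at hmem
  simp only [LinearMap.comp_apply, LinearEquiv.coe_coe]
  revert hmem
  generalize e (W.mkQ u) 0 = x
  generalize e (W.mkQ u) 1 = y
  generalize A u = z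
  revert x y z
  decide

/-- The quadratic case, where no factor splits off. -/
lemma hasProductForm_zero_of_split [Finite V] {f : V → ZMod 2} (φ : V →ₗ[ZMod 2] ZMod 2)
    {p s : V} (hs : φ s = 1) {A B : LinearMap.ker φ → ZMod 2}
    (hAdef : ∀ u : LinearMap.ker φ, f (u + p) = A u)
    (hBdef : ∀ u : LinearMap.ker φ, f (u + (p + s)) = A u + B u)
    (hA : IsFlat A) (hA₀ : A 0 = 1) (hAw : hWeight A * 4 = Nat.card (LinearMap.ker φ))
    (hB : DerivDegLE 1 B) (hB₀ : B 0 = 0) {b : LinearMap.ker φ} (hAb : A b = 1) (hBb : B b = 1) :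
    HasProductForm 0 f := by
  obtain ⟨z, hz, hAz⟩ := hA.exists_eq_mul hA₀ hAw
  let y : LinearMap.ker φ →ₗ[ZMod 2] ZMod 2 := AddMonoidHom.toZModLinearMap 2
    { toFun := B
      map_zero' := hB₀
      map_add' := fun u v => by
        have := hB v u 0
        simp only [zero_add, hB₀, add_zero] at this
        rw [← this, add_comm (B (u + v)), ← add_assoc, CharTwo.add_self_eq_zero, zero_add] }
  have hy (u : LinearMap.ker φ) : y u = B u := rfl
  have hzb : z b = 0 := by
    rw [hAz] at hAb
    have : z b 0 = 0 ∧ z b 1 = 0 := by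
      revert hAb
      generalize z b 0 = x
      generalize z b 1 = y
      revert x y
      decide
    rw [funext_iff, Fin.forall_fin_two]
    exact this
  let P := projKer φ hs
  let ψ : ℕ → V →ₗ[ZMod 2] ZMod 2 := fun j => match j with
    | 0 => LinearMap.proj 0 ∘ₗ z ∘ₗ P
    | 1 => LinearMap.proj 1 ∘ₗ z ∘ₗ P
    | 2 => φ
    | _ => y ∘ₗ P
  let c : ℕ → ZMod 2 := fun j => match j with
    | 0 => 1 + z (P p) 0
    | 1 => 1 + z (P p) 1
    | 2 => φ p
    | _ => y (P p)
  refine ⟨c, ψ, fun t => ?_, fun t => ?_⟩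
  · obtain ⟨u, hu⟩ := hz ![t 0, t 1]
    refine ⟨((u + (t 3 + y u) • b : LinearMap.ker φ) : V) + t 2 • s, fun j hj => ?_⟩
    have hP : P (((u + (t 3 + y u) • b : LinearMap.ker φ) : V) + t 2 • s) =
        u + (t 3 + y u) • b := by
      rw [map_add, map_smul, projKer_coe, projKer_self, smul_zero, add_zero]
    have hyb : y b = 1 := hBb
    interval_cases j
    · simp only [ψ, LinearMap.comp_apply, hP]
      simp [hzb, hu]
    · simp only [ψ, LinearMap.comp_apply, hP]
      simp [hzb, hu]
    · simp [ψ, hs]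
    · simp only [ψ, LinearMap.comp_apply, hP]
      simp only [map_add, map_smul, hyb, smul_eq_mul, mul_one]
      rw [add_comm (t 3), ← add_assoc, CharTwo.add_self_eq_zero, zero_add]
  · have hf : f t = A (P (t + p)) + (φ t + φ p) * B (P (t + p)) := by
      have ht := projKer_decomp φ hs p t
      rcases eq_or_ne (φ t + φ p) 0 with h | h
      · rw [h, zero_smul, add_zero] at ht
        rw [h, zero_mul, add_zero, ← hAdef, ht]
      · rw [zmod_two_eq_one_of_ne_zero h, one_smul, add_assoc] at ht
        rw [zmod_two_eq_one_of_ne_zero h, one_mul, ← hBdef, ht]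
    rw [hf, hAz, ← hy]
    simp only [c, ψ, LinearMap.comp_apply, LinearMap.proj_apply, map_add, Pi.add_apply,
      Finset.range_zero, Finset.prod_empty]
    ring

/-- In higher degree the support lies in a hyperplane. -/
lemma exists_restrict_eq_zero_of_split [Finite V] {f : V → ZMod 2} (φ : V →ₗ[ZMod 2] ZMod 2)
    {p s : V} (hs : φ s = 1) {A B : LinearMap.ker φ → ZMod 2}
    (hAdef : ∀ u : LinearMap.ker φ, f (u + p) = A u)
    (hBdef : ∀ u : LinearMap.ker φ, f (u + (p + s)) = A u + B u)
    (hA : IsFlat A) (hA₀ : A 0 = 1) (hB : IsFlat B) (hB₀ : B 0 = 0)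
    (hBw : 2 * hWeight B < Nat.card (LinearMap.ker φ))
    (hAB : 2 * hWeight (fun u => A u * B u) = hWeight A)
    {b : LinearMap.ker φ} (hAb : A b = 1) (hBb : B b = 1) :
    ∃ (φ' : V →ₗ[ZMod 2] ZMod 2) (s' p' : V), φ' s' = 1 ∧
      ∀ u : LinearMap.ker φ', f (u + p') = 0 := by
  have hbb : b + b = 0 := ZModModule.add_self b
  have hB₀' : B 0 ≠ 1 := by
    rw [hB₀]
    decide
  have hor (u : LinearMap.ker φ) : B u + B (u + b) = 1 ↔ B u = 1 ∨ B (u + b) = 1 := by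
    have : ¬ (B u = 1 ∧ B (u + b) = 1) := fun h => hB₀' (by
      have := hB _ _ _ h.1 h.2 hBb
      have h' : u + (u + b) + b = (u + u) + (b + b) := by abel
      rwa [h', hbb, ZModModule.add_self, add_zero] at this)
    revert this
    generalize B u = x
    generalize B (u + b) = y
    revert x y
    decide
  have hC : IsFlat fun u => B u + B (u + b) := by
    intro u v w hu hv hw
    rw [hor] at *
    have red (x y : LinearMap.ker φ) (h : B x = 1) (hxy : x = y + (b + b)) : B y = 1 := by
      rwa [hxy, hbb, add_zero] at h
    rcases hu with hu | hu <;> rcases hv with hv | hv <;> rcases hw with hw | hw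
    · exact Or.inl (hB _ _ _ hu hv hw)
    · exact Or.inr (by convert hB _ _ _ hu hv hw using 1; abel_nf)
    · exact Or.inr (by convert hB _ _ _ hu hv hw using 1; abel_nf)
    · exact Or.inl (red _ _ (hB _ _ _ hu hv hw) (by abel))
    · exact Or.inr (by convert hB _ _ _ hu hv hw using 1; abel_nf)
    · exact Or.inl (red _ _ (hB _ _ _ hu hv hw) (by abel))
    · exact Or.inl (red _ _ (hB _ _ _ hu hv hw) (by abel))
    · exact Or.inr (red _ _ (hB _ _ _ hu hv hw) (by abel))
  have hC₀ : B 0 + B (0 + b) = 1 := by rw [zero_add, hB₀, hBb, zero_add]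
  have hproper : hC.toSubmodule hC₀ < ⊤ := by
    rw [lt_top_iff_ne_top]
    intro htop
    have hall (u : LinearMap.ker φ) : B u + B (u + b) = 1 := by
      have : u ∈ hC.toSubmodule hC₀ := htop ▸ Submodule.mem_top
      exact this
    have h₁ := hWeight_add B fun u => B (u + b)
    have h₂ := hWeight_comp_equiv (Equiv.addRight b) B
    simp only [Equiv.coe_addRight] at h₂
    simp only [hall, hWeight_one] at h₁
    omega
  obtain ⟨ψ, hψ, hle⟩ := Submodule.exists_le_ker_of_lt_top _ hproper
  have hBψ {u : LinearMap.ker φ} (hu : B u = 1 ∨ B (u + b) = 1) : ψ u = 0 :=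
    hle ((hor u).mpr hu)
  have hAψ {u : LinearMap.ker φ} (hu : A u = 1) : ψ u = 0 :=
    hBψ (hA.eq_one_or_of_two_mul_hWeight_mul_eq hB hA₀ hB₀' hAB hAb hBb hu)
  obtain ⟨a, ha⟩ := exists_apply_eq_one hψ
  refine ⟨ψ ∘ₗ projKer φ hs, a, p + a, by rw [LinearMap.comp_apply, projKer_coe, ha], fun t => ?_⟩
  by_contra hne
  have hψt : ψ (projKer φ hs ((t : V) + (p + a) + p)) = 1 := by
    have h₁ : (t : V) + (p + a) + p = t + a + (p + p) := by abel
    have h₂ : ψ (projKer φ hs t) = 0 := t.2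
    rw [h₁, ZModModule.add_self, add_zero, map_add, map_add, h₂, projKer_coe, ha, zero_add]
  have hone := zmod_two_eq_one_of_ne_zero hne
  rw [← projKer_decomp φ hs p ((t : V) + (p + a))] at hone
  have hzero : ψ (projKer φ hs ((t : V) + (p + a) + p)) = 0 := by
    revert hone
    generalize projKer φ hs ((t : V) + (p + a) + p) = w
    refine add_smul_cases (P := fun x => x = 1 → ψ w = 0) _ _ _ ?_ ?_
    · rw [hAdef]
      exact hAψ
    · rw [add_assoc, hBdef]
      intro h
      by_cases hu : A w = 1
      · exact hAψ hu
      · refine hBψ (Or.inl ?_)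
        revert h hu
        generalize A w = x
        generalize B w = y
        revert x y
        decide
  rw [hψt] at hzero
  exact one_ne_zero hzero

/-- Boolean functions of degree at most `r` whose weight is `3/2` of the minimum distance. -/
theorem DerivDegLE.exists_hasProductForm [Finite V] {r : ℕ} {f : V → ZMod 2}
    (hf : DerivDegLE r f) (hw : 2 * hWeight f * 2 ^ r = 3 * Nat.card V) :
    ∃ k, r = k + 2 ∧ HasProductForm k f := by
  induction r generalizing V with
  | zero =>
    have hcpos : 0 < Nat.card V := Nat.card_pos
    rcases eq_or_ne (f 0) 0 with h | h
    · have : f = fun _ => 0 := funext fun u => by rw [hf u 0, h]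
      rw [this, hWeight_zero] at hw
      omega
    · have : f = fun _ => 1 := funext fun u => by
        rw [hf u 0, zmod_two_eq_one_of_ne_zero h]
      rw [this, hWeight_one] at hw
      omega
  | succ r ih =>
  by_cases hvan : ∃ (φ : V →ₗ[ZMod 2] ZMod 2) (s p : V), φ s = 1 ∧
      ∀ u : LinearMap.ker φ, f (u + p) = 0
  · obtain ⟨φ, s, p, hs, h₀⟩ := hvan
    have hsplit := hWeight_split φ hs p f
    have hdeg := hf.restrict_add φ p s
    simp only [h₀, hWeight_zero, zero_add] at hsplit hdeg
    obtain ⟨k, rfl, hk⟩ := ih hdeg (by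
      rw [card_eq_two_mul_card_ker φ hs, hsplit, pow_succ] at hw
      linarith)
    exact ⟨k + 1, rfl, hk.of_restrict φ hs p h₀⟩
  have hcpos : 0 < Nat.card V := Nat.card_pos
  have hnonvan (φ : V →ₗ[ZMod 2] ZMod 2) (s p : V) (hs : φ s = 1) :
      ∃ u : LinearMap.ker φ, f (u + p) = 1 := by
    by_contra! h
    refine hvan ⟨φ, s, p, hs, fun u => ?_⟩
    by_contra h'
    exact h u (zmod_two_eq_one_of_ne_zero h')
  have hf₀ : hWeight f ≠ 0 := by
    intro h
    rw [h] at hw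
    omega
  obtain ⟨v, hv⟩ : ∃ v, f v = 0 := by
    by_contra! h
    have : f = fun _ => 1 := funext fun u => zmod_two_eq_one_of_ne_zero (h u)
    rw [this, hWeight_one, mul_right_comm] at hw
    have := Nat.eq_of_mul_eq_mul_right hcpos hw
    omega
  obtain ⟨φ, hφ, hne⟩ := exists_unbalanced hf₀ hv
  obtain ⟨s₀, hs₀⟩ := exists_apply_eq_one hφ
  obtain ⟨u₀, hp⟩ := hnonvan φ s₀ v hs₀
  obtain ⟨u₁, hq⟩ := hnonvan φ s₀ (v + s₀) hs₀
  obtain ⟨p, hpdef⟩ : ∃ p, p = u₀ + v := ⟨_, rfl⟩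
  obtain ⟨s, hqdef⟩ : ∃ s, p + s = u₁ + (v + s₀) := ⟨u₁ + (v + s₀) - p, by abel⟩
  rw [← hpdef] at hp
  rw [← hqdef] at hq
  have hφp : φ p = φ v := by rw [hpdef, map_add, show φ u₀ = 0 from u₀.2, zero_add]
  have hs : φ s = 1 := by
    have := congrArg φ hqdef
    rw [map_add, map_add, map_add, show φ u₁ = 0 from u₁.2, hs₀, hφp, zero_add] at this
    exact add_left_cancel this
  have hcard := card_eq_two_mul_card_ker φ hs
  have hsplit := hWeight_split φ hs p f
  have hunb : hWeight (fun u : LinearMap.ker φ => f (u + p)) ≠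
      hWeight (fun u : LinearMap.ker φ => f (u + (p + s))) := by
    have h := hWeight_split φ hs p fun u => f u * (φ u + φ v)
    have h₀ (u : LinearMap.ker φ) : φ (u + p) + φ v = 0 := by
      rw [map_add, show φ u = 0 from u.2, hφp, zero_add, CharTwo.add_self_eq_zero]
    have h₁ (u : LinearMap.ker φ) : φ (u + (p + s)) + φ v = 1 := by
      rw [map_add, map_add, show φ u = 0 from u.2, hφp, hs, zero_add, add_right_comm,
        CharTwo.add_self_eq_zero, zero_add]
    simp only [h₀, h₁, mul_zero, mul_one, hWeight_zero, zero_add] at h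
    omega
  clear hne hpdef hqdef u₀ u₁ hφp
  wlog hlt : hWeight (fun u : LinearMap.ker φ => f (u + p)) <
      hWeight (fun u : LinearMap.ker φ => f (u + (p + s))) generalizing p
  · have hpss : p + s + s = p := by rw [add_assoc, ZModModule.add_self, add_zero]
    refine this (p + s) hq (by rwa [hpss]) ?_ ?_ ?_ <;> rw [hpss]
    · rw [hsplit, add_comm]
    · exact hunb.symm
    · omega
  obtain ⟨A, hAdef⟩ : ∃ A, A = fun u : LinearMap.ker φ => f (u + p) := ⟨_, rfl⟩
  obtain ⟨h, hhdef⟩ : ∃ h, h = fun u : LinearMap.ker φ => f (u + (p + s)) := ⟨_, rfl⟩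
  obtain ⟨B, hBdef⟩ : ∃ B, B = fun u => A u + h u := ⟨_, rfl⟩
  rw [← hAdef, ← hhdef] at hsplit hlt
  have hA₀ : A 0 = 1 := by simpa [hAdef] using hp
  have hh₀ : h 0 = 1 := by simpa [hhdef] using hq
  have hB₀ : B 0 = 0 := by
    rw [hBdef]
    simp only [hA₀, hh₀]
    decide
  have hAdeg : DerivDegLE (r + 1) A := by
    rw [hAdef]
    exact hf.restrict φ p
  have hBdeg : DerivDegLE r B := by
    rw [hBdef, hAdef, hhdef]
    exact hf.restrict_add φ p s
  have hpow : 0 < 2 ^ (r + 1) := by positivity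
  obtain ⟨hA, hAw⟩ := hAdeg.isFlat_of_hWeight_lt ⟨0, hA₀⟩ (by
    have h₁ : (2 * (2 * hWeight A)) * 2 ^ (r + 1) < (2 * hWeight f) * 2 ^ (r + 1) :=
      Nat.mul_lt_mul_of_pos_right (by omega) hpow
    linarith)
  have hhw : hWeight h = 2 * hWeight A := by
    rw [hsplit, hcard, ← hAw] at hw
    have : 2 * (hWeight A + hWeight h) = 6 * hWeight A := by
      refine Nat.eq_of_mul_eq_mul_right hpow ?_
      linarith
    omega
  obtain ⟨hB, hBw, -, hAB⟩ := hf.isFlat_add_of_split φ hp hq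
    (fun g hg hx hgw => hg.isFlat_of_hWeight_lt hx hgw) hAdef hhdef hBdef hA hAw hhw.le
    fun hAh => by
      rw [hAh] at hlt
      omega
  have hApos : 0 < hWeight A := hWeight_pos hA₀
  obtain ⟨b, hb⟩ := exists_eq_one_of_hWeight_ne_zero
    (f := fun u => A u * B u) (fun h₀ => by omega)
  have hb' : A b = 1 ∧ B b = 1 := by
    revert hb
    generalize A b = x
    generalize B b = y
    revert x y
    decide
  have hfA (u : LinearMap.ker φ) : f (u + p) = A u := by rw [hAdef]
  have hfB (u : LinearMap.ker φ) : f (u + (p + s)) = A u + B u := by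
    rw [hBdef]
    simp only
    rw [← add_assoc (A u), CharTwo.add_self_eq_zero, zero_add, hhdef]
  match r with
  | 0 => exact (one_ne_zero (hb'.2.symm.trans ((hBdeg b 0).trans hB₀))).elim
  | 1 => exact ⟨0, rfl,
      hasProductForm_zero_of_split φ hs hfA hfB hA hA₀ hAw hBdeg hB₀ hb'.1 hb'.2⟩
  | r + 2 =>
    obtain ⟨φ', s', p', hs', hp'⟩ := exists_restrict_eq_zero_of_split φ hs hfA hfB hA hA₀ hB hB₀
      (by
        rw [hBw, ← hAw]
        have : 8 ≤ 2 ^ (r + 2 + 1) := by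
          calc 8 = 2 ^ 3 := by norm_num
            _ ≤ _ := Nat.pow_le_pow_right (by norm_num) (by omega)
        nlinarith) hAB hb'.1 hb'.2
    exact (hvan ⟨φ', s', p', hs', hp'⟩).elim

end Hyperplane

lemma affForm_eq (m : ℕ) (c : ZMod 2) (φ : Point m →ₗ[ZMod 2] ZMod 2) :
    affForm m c (fun i => φ (Pi.single i 1)) = fun u => c + φ u := by
  funext u
  rw [affForm, LinearMap.pi_apply_eq_sum_univ φ u]
  congr 1
  refine Finset.sum_congr rfl fun i _ => ?_
  rw [smul_eq_mul, mul_comm]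
  congr 2
  funext j
  rw [Pi.single_apply]
  simp only [eq_comm]

lemma wt_eq_hWeight (m : ℕ) (P : Fn m) : wt m P = hWeight P := by
  rw [← natCard_eq_hWeight, Nat.card_eq_fintype_card, Fintype.card_subtype]
  rfl

/-- a polynomial of degree ≤ r and weight `3·2^(m-r-1)` factors as
`y_1⋯y_{r-2}(y_{r-1}y_r + y_{r+1}y_{r+2})` for `r+2` linearly independent affine forms. -/
theorem stmt8 (m r : ℕ) (hm : 1 ≤ m) (hr : r < m) (P : Fn m)
    (hdeg : degLE m P r) (hw : wt m P = 3 * 2 ^ (m - r - 1)) :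
    ∃ (c : ℕ → ZMod 2) (a : ℕ → Point m),
      LinearIndependent (ZMod 2) (fun j : Fin (r + 2) => a j.1) ∧
      P = (∏ j ∈ Finset.range (r - 2), affForm m (c j) (a j)) *
          (affForm m (c (r - 2)) (a (r - 2)) * affForm m (c (r - 1)) (a (r - 1)) +
            affForm m (c r) (a r) * affForm m (c (r + 1)) (a (r + 1))) := by
  have hcard : Nat.card (Point m) = 2 ^ m := by simp
  have hexp : (2 : ℕ) ^ m = 2 * 2 ^ (m - r - 1) * 2 ^ r := by
    rw [← pow_succ', ← pow_add]
    congr 1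
    omega
  obtain ⟨k, rfl, c, φ, hsurj, hform⟩ := hdeg.derivDegLE.exists_hasProductForm (by
    rw [← wt_eq_hWeight, hw, hcard, hexp]
    ring)
  refine ⟨c, fun j i => φ j (Pi.single i 1), ?_, ?_⟩
  · rw [Fintype.linearIndependent_iff]
    intro g hg j
    obtain ⟨u, hu⟩ := hsurj fun i => if i = j.1 then 1 else 0
    have hcomb : ∑ i : Fin (k + 2 + 2), g i * φ i u = 0 := by
      have h (i : Fin (k + 2 + 2)) : φ i u = ∑ l, φ i (Pi.single l 1) * u l := by
        have := congrFun (affForm_eq m 0 (φ i)) u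
        simpa [affForm] using this.symm
      simp only [h, Finset.mul_sum]
      rw [Finset.sum_comm]
      refine Finset.sum_eq_zero fun l _ => ?_
      have := congrFun hg l
      simp only [Finset.sum_apply, Pi.smul_apply, smul_eq_mul, Pi.zero_apply] at this
      simp only [← mul_assoc, ← Finset.sum_mul, this, zero_mul]
    rw [Finset.sum_eq_single j] at hcomb
    · rwa [hu j (by omega), if_pos rfl, mul_one] at hcomb
    · intro i _ hij
      rw [hu i (by omega), if_neg (fun h => hij (Fin.ext h)), mul_zero]
    · simp
  · funext u
    rw [hform u]
    simp only [affForm_eq, Nat.add_sub_cancel, Pi.mul_apply, Pi.add_apply, Finset.prod_apply]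
    rfl
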